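/- Let N be a Nijenhuis operator on a compatible Hom-Leibniz algebra (L,[·,·],{·,·},α) with μ_0 = [·,·] and m_0 = {·,·}. Define μ_1(x,y) = [x,N(y)] + [N(x),y] − N([x,y]) and m_1(x,y) = {x,N(y)} + {N(x),y} − N({x,y}). Then (μ_1,m_1) = d^1 N = ([μ_0,N]_B, [m_0,N]_B) is a 2-coboundary, (μ_1,m_1) generates an infinitesimal deformation of (L,μ_0,m_0,α) (i.e. (L, μ_0 + tμ_1, m_0 + tm_1, α) is a compatible Hom-Leibniz algebra for all t ∈ K), and this deformation is trivial: Id + tN : (L,μ_t,m_t,α) → (L,μ_0,m_0,α) is a compatible Hom-Leibniz algebra homomorphism for all t. -/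

import Mathlib

open Finset

variable {K : Type*} [Field K] [CharZero K]
variable {L : Type*} [AddCommGroup L] [Module K L]
variable {M : Type*} [AddCommGroup M] [Module K M]

/-- A bilinear map, phrased for plain curried functions. -/
def IsBilinMap (K : Type*) [Field K] {L M N : Type*} [AddCommGroup L] [Module K L]
    [AddCommGroup M] [Module K M] [AddCommGroup N] [Module K N] (b : L → M → N) : Prop :=
  (∀ x, IsLinearMap K (b x)) ∧ (∀ y, IsLinearMap K (fun x => b x y))

/-- A multiplicative Hom-Leibniz algebra structure `(L, b, α)`:
`α` linear, `b` bilinear, `α` multiplicative for `b`, and the Hom-Leibniz identity. -/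
def IsHomLeibniz (K : Type*) [Field K] {L : Type*} [AddCommGroup L] [Module K L]
    (α : L → L) (b : L → L → L) : Prop :=
  IsLinearMap K α ∧ IsBilinMap K b ∧
  (∀ x y, α (b x y) = b (α x) (α y)) ∧
  (∀ x y z, b (α x) (b y z) = b (b x y) (α z) + b (α y) (b x z))

/-- A compatible Hom-Leibniz algebra structure `(L, b₁, b₂, α)`. -/
def IsCompatibleHomLeibniz (K : Type*) [Field K] {L : Type*} [AddCommGroup L] [Module K L]
    (α : L → L) (b₁ b₂ : L → L → L) : Prop :=
  IsHomLeibniz K α b₁ ∧ IsHomLeibniz K α b₂ ∧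
  (∀ x y z, b₁ (α x) (b₂ y z) + b₂ (α x) (b₁ y z) =
    b₁ (b₂ x y) (α z) + b₂ (b₁ x y) (α z) + b₁ (α y) (b₂ x z) + b₂ (α y) (b₁ x z))

/-- A Nijenhuis operator on a multiplicative Hom-Leibniz algebra `(L, b, α)`. -/
def IsNijenhuis (K : Type*) [Field K] {L : Type*} [AddCommGroup L] [Module K L]
    (α : L → L) (b : L → L → L) (N : L → L) : Prop :=
  IsLinearMap K N ∧ (∀ x, N (α x) = α (N x)) ∧
  (∀ x y, N (b x (N y) + b (N x) y - N (b x y)) = b (N x) (N y))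

/-- The deformed bracket `[x,y]_N = b(x,Ny) + b(Nx,y) − N(b(x,y))`. -/
def nijBracket {L : Type*} [AddCommGroup L] (b : L → L → L) (N : L → L) : L → L → L :=
  fun x y => b x (N y) + b (N x) y - N (b x y)

/-- A homomorphism of compatible Hom-Leibniz algebras
`φ : (L, b₁, c₁, α₁) → (L', b₂, c₂, α₂)`. -/
def IsCompatHom (K : Type*) [Field K] {L L' : Type*} [AddCommGroup L] [Module K L]
    [AddCommGroup L'] [Module K L'] (α₁ : L → L) (α₂ : L' → L')
    (b₁ c₁ : L → L → L) (b₂ c₂ : L' → L' → L') (φ : L → L') : Prop :=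
  IsLinearMap K φ ∧
  (∀ x y, φ (b₁ x y) = b₂ (φ x) (φ y)) ∧
  (∀ x y, φ (c₁ x y) = c₂ (φ x) (φ y)) ∧
  (∀ x, φ (α₁ x) = α₂ (φ x))

theorem IsNijenhuis.add {F V : Type*} [Field F] [AddCommGroup V] [Module F V]
    {α : V → V} {b c : V → V → V} {N : V → V}
    (hb : IsNijenhuis F α b N) (hc : IsNijenhuis F α c N) :
    IsNijenhuis F α (fun x y => b x y + c x y) N := by
  obtain ⟨hN, hNα, hb⟩ := hb
  obtain ⟨-, -, hc⟩ := hc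
  refine ⟨hN, hNα, fun x y => ?_⟩
  have e₁ := hb x y
  have e₂ := hc x y
  simp only [hN.map_add, hN.map_sub] at e₁ e₂ ⊢
  rw [← e₁, ← e₂]
  abel

theorem IsCompatibleHomLeibniz.isHomLeibniz_add {F V : Type*} [Field F] [AddCommGroup V] [Module F V]
    {α : V → V} {b c : V → V → V}
    (h : IsCompatibleHomLeibniz F α b c) :
    IsHomLeibniz F α (fun x y => b x y + c x y) := by
  obtain ⟨⟨hα, ⟨bl, br⟩, bm, bL⟩, ⟨-, ⟨cl, cr⟩, cm, cL⟩, hbc⟩ := h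
  refine ⟨hα, ⟨fun x => ?_, fun y => ?_⟩, fun x y => ?_, fun x y z => ?_⟩
  · exact ((bl x).mk' _ + (cl x).mk' _).isLinear
  · exact ((br y).mk' _ + (cr y).mk' _).isLinear
  · simp only [hα.map_add, bm, cm]
  · have b_add_left : ∀ x y z, b (x + y) z = b x z + b y z := fun x y z => (br z).map_add x y
    have c_add_left : ∀ x y z, c (x + y) z = c x z + c y z := fun x y z => (cr z).map_add x y
    simp only [(bl _).map_add, (cl _).map_add, b_add_left, c_add_left]
    linear_combination (norm := module) bL x y z + cL x y z + hbc x y z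

/-- Two Hom-Leibniz structures whose sum is Hom-Leibniz are compatible. -/
theorem IsHomLeibniz.isCompatibleHomLeibniz {F V : Type*} [Field F] [AddCommGroup V] [Module F V]
    {α : V → V} {b c : V → V → V}
    (hb : IsHomLeibniz F α b) (hc : IsHomLeibniz F α c)
    (hbc : IsHomLeibniz F α (fun x y => b x y + c x y)) :
    IsCompatibleHomLeibniz F α b c := by
  refine ⟨hb, hc, fun x y z => ?_⟩
  obtain ⟨-, ⟨bl, br⟩, -, bL⟩ := hb
  obtain ⟨-, ⟨cl, cr⟩, -, cL⟩ := hc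
  have b_add_left : ∀ x y z, b (x + y) z = b x z + b y z := fun x y z => (br z).map_add x y
  have c_add_left : ∀ x y z, c (x + y) z = c x z + c y z := fun x y z => (cr z).map_add x y
  have e := hbc.2.2.2 x y z
  simp only [(bl _).map_add, (cl _).map_add, b_add_left, c_add_left] at e
  linear_combination (norm := module) e - bL x y z - cL x y z

theorem IsHomLeibniz.deform {F V : Type*} [Field F] [AddCommGroup V] [Module F V]
    {α : V → V} {b : V → V → V} {N : V → V}
    (hb : IsHomLeibniz F α b) (h : IsNijenhuis F α b N) (t : F) :
    IsHomLeibniz F α (fun x y => b x y + t • nijBracket b N x y) := by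
  obtain ⟨hα, ⟨bl, br⟩, bm, bL⟩ := hb
  obtain ⟨hN, hNα, hNb⟩ := h
  have b_add_left : ∀ x y z, b (x + y) z = b x z + b y z := fun x y z => (br z).map_add x y
  have b_sub_left : ∀ x y z, b (x - y) z = b x z - b y z := fun x y z => (br z).map_sub x y
  have b_smul_left : ∀ (s : F) x z, b (s • x) z = s • b x z := fun s x z => (br z).map_smul s x
  refine ⟨hα, ⟨fun x => ⟨fun y z => ?_, fun s y => ?_⟩, fun y => ⟨fun x z => ?_, fun s x => ?_⟩⟩,
    fun x y => ?_, fun x y z => ?_⟩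
  iterate 4
    simp only [nijBracket, hN.map_add, hN.map_smul, (bl _).map_add, (bl _).map_smul,
      b_add_left, b_smul_left]
    module
  · simp only [nijBracket, hα.map_add, hα.map_smul, hα.map_sub, bm, hNα, ← hNα (b _ _)]
  · have nij : ∀ x y, b (N x) (N y) = N (b x (N y)) + N (b (N x) y) - N (N (b x y)) :=
      fun x y => by rw [← hNb, hN.map_sub, hN.map_add]
    have L₁ := bL (N x) y z
    have L₂ := bL x (N y) z
    have L₃ := bL x y (N z)
    have L₁₂ := bL (N x) (N y) z
    have L₁₃ := bL (N x) y (N z)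
    have L₂₃ := bL x (N y) (N z)
    have NL := congrArg N (bL x y z)
    have NNL := congrArg (fun v => N (N v)) (bL x y z)
    have NL₁ := congrArg N L₁
    have NL₂ := congrArg N L₂
    have NL₃ := congrArg N L₃
    have n₁ := nij (α x) (b y z)
    have n₂ := nij (b x y) (α z)
    have n₃ := nij (α y) (b x z)
    simp only [hN.map_add, hNα] at NL NNL NL₁ NL₂ NL₃ n₁ n₂ n₃
    simp only [nijBracket, hN.map_add, hN.map_smul, hN.map_sub, (bl _).map_add, (bl _).map_smul,
      (bl _).map_sub, b_add_left, b_smul_left, b_sub_left, hNα]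
    have q₁ := congrArg (b (α x)) (hNb y z)
    have q₂ := congrArg (fun v => b v (α z)) (hNb x y)
    have q₃ := congrArg (b (α y)) (hNb x z)
    simp only [hN.map_add, hN.map_sub, (bl _).map_add, (bl _).map_sub, b_add_left,
      b_sub_left] at q₁ q₂ q₃
    linear_combination (norm := module) bL x y z + t • (L₁ + L₂ + L₃ - NL) +
      t ^ 2 • (L₁₂ + L₁₃ + L₂₃ - NL₁ - NL₂ - NL₃ + NNL + q₁ - q₂ - q₃ - n₁ + n₂ + n₃)

theorem IsNijenhuis.id_add_smul_map {F V : Type*} [Field F] [AddCommGroup V] [Module F V]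
    {α : V → V} {b : V → V → V} {N : V → V}
    (h : IsNijenhuis F α b N) (hb : IsBilinMap F b) (t : F) (x y : V) :
    b x y + t • nijBracket b N x y + t • N (b x y + t • nijBracket b N x y) =
      b (x + t • N x) (y + t • N y) := by
  obtain ⟨hN, -, hNb⟩ := h
  obtain ⟨bl, br⟩ := hb
  have b_add_left : ∀ x y z, b (x + y) z = b x z + b y z := fun x y z => (br z).map_add x y
  have b_smul_left : ∀ (s : F) x z, b (s • x) z = s • b x z := fun s x z => (br z).map_smul s x
  have e := hNb x y
  simp only [nijBracket, hN.map_add, hN.map_smul, hN.map_sub, (bl _).map_add, (bl _).map_smul,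
    b_add_left, b_smul_left] at e ⊢
  linear_combination (norm := module) t ^ 2 • e

/-- A Nijenhuis operator `N` on a compatible Hom-Leibniz
algebra `(L,μ₀,m₀,α)` gives rise to a trivial infinitesimal deformation: with
`μ₁ = (μ₀)_N` and `m₁ = (m₀)_N` (i.e. `(μ₁,m₁) = d¹N = ([μ₀,N]_B,[m₀,N]_B)`),
`(L, μ₀ + tμ₁, m₀ + tm₁, α)` is a compatible Hom-Leibniz algebra for every `t`,
and `Id + tN : (L,μ_t,m_t,α) → (L,μ₀,m₀,α)` is a homomorphism for every `t`. -/
theorem nijenhuis_gives_trivial_deformation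
    (α : L → L) (μ₀ m₀ : L → L → L) (h : IsCompatibleHomLeibniz K α μ₀ m₀)
    (N : L → L) (hN₁ : IsNijenhuis K α μ₀ N) (hN₂ : IsNijenhuis K α m₀ N) :
    (∀ x y, nijBracket μ₀ N x y = μ₀ x (N y) + μ₀ (N x) y - N (μ₀ x y)) ∧
    (∀ t : K, IsCompatibleHomLeibniz K α
        (fun x y => μ₀ x y + t • nijBracket μ₀ N x y)
        (fun x y => m₀ x y + t • nijBracket m₀ N x y)) ∧
    (∀ t : K, IsCompatHom K α α
        (fun x y => μ₀ x y + t • nijBracket μ₀ N x y)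
        (fun x y => m₀ x y + t • nijBracket m₀ N x y)
        μ₀ m₀ (fun z => z + t • N z)) := by
  refine ⟨fun _ _ => rfl, fun t => ?_, fun t => ⟨?_, ?_, ?_, fun x => ?_⟩⟩
  · refine (h.1.deform hN₁ t).isCompatibleHomLeibniz (h.2.1.deform hN₂ t) ?_
    convert h.isHomLeibniz_add.deform (hN₁.add hN₂) t using 3 with x y
    simp only [nijBracket, hN₁.1.map_add]
    module
  · exact (LinearMap.id + t • hN₁.1.mk' N).isLinear
  · exact hN₁.id_add_smul_map h.1.2.1 t
  · exact hN₂.id_add_smul_map h.2.1.2.1 t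
  · simp only [hN₁.2.1, h.1.1.map_add, h.1.1.map_smul]
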